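/- Suppose Z is a random variable taking values in a probability simplex (Q₁,...,Q_m) with each Q_j ∈ [0,1] and ∑ Q_j = 1, and suppose for every pair of distinct j, k, E[Q_j Q_k] ≤ ε for some ε ∈ (0, 1/(2m²)). Then P(max_j Q_j ≤ 1 - √(m²ε)) ≤ √(m²ε)/(1-√(m²ε)). -/

import Mathlib

open MeasureTheory Finset

theorem sum_offDiag_mul_eq_one_sub_sum_sq {ι : Type*} [Fintype ι] [DecidableEq ι] (q : ι → ℝ)
    (hq : ∑ j, q j = 1) :
    ∑ p ∈ (univ : Finset ι).offDiag, q p.1 * q p.2 = 1 - ∑ j, q j ^ 2 := by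
  have h := Finset.sum_union (Finset.disjoint_diag_offDiag (univ : Finset ι))
    (f := fun p : ι × ι => q p.1 * q p.2)
  rw [Finset.diag_union_offDiag, Finset.sum_product, ← Finset.sum_mul_sum, hq, Finset.sum_diag] at h
  simp only [sq]
  linarith

theorem le_sum_offDiag_mul {ι : Type*} [Fintype ι] [DecidableEq ι] (q : ι → ℝ)
    (hq₀ : ∀ j, 0 ≤ q j) (hq : ∑ j, q j = 1) {η : ℝ} (hη : ∀ j, q j ≤ 1 - η) :
    η ≤ ∑ p ∈ (univ : Finset ι).offDiag, q p.1 * q p.2 := by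
  rw [sum_offDiag_mul_eq_one_sub_sum_sq q hq]
  have h : ∑ j, q j ^ 2 ≤ ∑ j, (1 - η) * q j :=
    Finset.sum_le_sum fun j _ => by nlinarith [hq₀ j, hη j]
  rw [← Finset.mul_sum, hq] at h
  linarith

theorem stmt_11 {Ω : Type*} [MeasurableSpace Ω] (μ : Measure Ω) [IsProbabilityMeasure μ]
    {m : ℕ} (hm : 2 ≤ m) (Q : Ω → Fin m → ℝ)
    (hmeas : ∀ j, Measurable (fun ω => Q ω j))
    (hQ01 : ∀ ω j, Q ω j ∈ Set.Icc (0 : ℝ) 1)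
    (hQsum : ∀ ω, ∑ j : Fin m, Q ω j = 1)
    (ε : ℝ) (hε : ε ∈ Set.Ioo (0 : ℝ) (1 / (2 * m ^ 2)))
    (hpair : ∀ j k : Fin m, j ≠ k → ∫ ω, Q ω j * Q ω k ∂μ ≤ ε) :
    μ {ω | ∀ j, Q ω j ≤ 1 - Real.sqrt (m ^ 2 * ε)}
      ≤ ENNReal.ofReal (Real.sqrt (m ^ 2 * ε) / (1 - Real.sqrt (m ^ 2 * ε))) := by
  obtain ⟨hε₀, hε₁⟩ := hε
  have hm₀ : (0 : ℝ) < m := by exact_mod_cast (by omega : 0 < m)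
  set η := Real.sqrt (m ^ 2 * ε)
  have hη₀ : 0 < η := Real.sqrt_pos.2 (by positivity)
  have hη_sq : η ^ 2 = m ^ 2 * ε := Real.sq_sqrt (by positivity)
  have hη₁ : η < 1 := by
    rw [lt_div_iff₀ (by positivity)] at hε₁
    nlinarith
  let f : Ω → ℝ := fun ω => ∑ p ∈ (univ : Finset (Fin m)).offDiag, Q ω p.1 * Q ω p.2
  have hint (p : Fin m × Fin m) : Integrable (fun ω => Q ω p.1 * Q ω p.2) μ := by
    refine Integrable.of_bound ((hmeas p.1).mul (hmeas p.2)).aestronglyMeasurable 1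
      (ae_of_all _ fun ω => ?_)
    rw [Real.norm_of_nonneg (mul_nonneg (hQ01 ω p.1).1 (hQ01 ω p.2).1)]
    exact mul_le_one₀ (hQ01 ω p.1).2 (hQ01 ω p.2).1 (hQ01 ω p.2).2
  have hf_int : Integrable f μ := integrable_finsetSum _ fun p _ => hint p
  have hf_le : ∫ ω, f ω ∂μ ≤ η ^ 2 := by
    calc ∫ ω, f ω ∂μ
        = ∑ p ∈ (univ : Finset (Fin m)).offDiag, ∫ ω, Q ω p.1 * Q ω p.2 ∂μ :=
          integral_finsetSum _ fun p _ => hint p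
      _ ≤ ∑ _p ∈ (univ : Finset (Fin m)).offDiag, ε :=
          Finset.sum_le_sum fun p hp => hpair p.1 p.2 (Finset.mem_offDiag.1 hp).2.2
      _ ≤ ∑ _p : Fin m × Fin m, ε :=
          Finset.sum_le_sum_of_subset_of_nonneg (Finset.subset_univ _) fun _ _ _ => hε₀.le
      _ = η ^ 2 := by simp [hη_sq, sq]
  have hmarkov := mul_meas_ge_le_integral_of_nonneg (μ := μ)
    (ae_of_all _ fun ω => Finset.sum_nonneg fun p _ =>
      mul_nonneg (hQ01 ω p.1).1 (hQ01 ω p.2).1) hf_int η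
  have hreal : μ.real {ω | η ≤ f ω} ≤ η := by nlinarith
  calc μ {ω | ∀ j, Q ω j ≤ 1 - η}
      ≤ μ {ω | η ≤ f ω} :=
        measure_mono fun ω hω => le_sum_offDiag_mul (Q ω) (fun j => (hQ01 ω j).1) (hQsum ω) hω
    _ = ENNReal.ofReal (μ.real {ω | η ≤ f ω}) := by rw [ofReal_measureReal]
    _ ≤ ENNReal.ofReal (η / (1 - η)) := by
        refine ENNReal.ofReal_le_ofReal (hreal.trans ?_)
        rw [le_div_iff₀ (by linarith)]
        nlinarith
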